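/- arXiv:math/0105048 — 4 statements merged into one kernel-verified Lean document; each statement's English description precedes it below -/
import Mathlib

section
/- Let W0 and W1 be finite-dimensional complex vector spaces and let (μ, ρ, β) be a Lie superalgebra law on (W0, W1). Then the law is nilpotent (i.e., C^N(G) = 0 for some natural number N) if and only if there exist natural numbers p and q such that C^p(W0) = 0 and C^q(W1) = 0. -/
open Finset

noncomputable section
section Abstract

variable {W0 W1 : Type} [AddCommGroup W0] [Module ℂ W0] [AddCommGroup W1] [Module ℂ W1]

/-- A Lie superalgebra law `(μ, ρ, β)` on the pair `(W0, W1)`. -/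
def IsSuperLaw (μ : W0 →ₗ[ℂ] W0 →ₗ[ℂ] W0) (ρ : W0 →ₗ[ℂ] W1 →ₗ[ℂ] W1)
    (β : W1 →ₗ[ℂ] W1 →ₗ[ℂ] W0) : Prop :=
  (∀ x, μ x x = 0) ∧ (∀ h h', β h h' = β h' h) ∧
  (∀ x y z, μ x (μ y z) + μ y (μ z x) + μ z (μ x y) = 0) ∧
  (∀ x y h, ρ (μ x y) h = ρ x (ρ y h) - ρ y (ρ x h)) ∧
  (∀ x h h', μ x (β h h') = β (ρ x h) h' + β (ρ x h') h) ∧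
  (∀ h h' h'', ρ (β h h') h'' + ρ (β h' h'') h + ρ (β h'' h) h' = 0)

/-- The descending sequence `C^i(W0)` generated by `μ`. -/
def Ceven (μ : W0 →ₗ[ℂ] W0 →ₗ[ℂ] W0) : ℕ → Submodule ℂ W0
  | 0 => ⊤
  | k + 1 => Submodule.span ℂ {z | ∃ x u, u ∈ Ceven μ k ∧ z = μ x u}

/-- The descending sequence `C^i(W1)` generated by `ρ`. -/
def Codd (ρ : W0 →ₗ[ℂ] W1 →ₗ[ℂ] W1) : ℕ → Submodule ℂ W1
  | 0 => ⊤
  | k + 1 => Submodule.span ℂ {z | ∃ x v, v ∈ Codd ρ k ∧ z = ρ x v}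

/-- The lower central series of the superalgebra `G = W0 ⊕ W1`, as a pair of
subspaces `(C^i(G)_0, C^i(G)_1)`. -/
def lcs (μ : W0 →ₗ[ℂ] W0 →ₗ[ℂ] W0) (ρ : W0 →ₗ[ℂ] W1 →ₗ[ℂ] W1)
    (β : W1 →ₗ[ℂ] W1 →ₗ[ℂ] W0) : ℕ → Submodule ℂ W0 × Submodule ℂ W1
  | 0 => (⊤, ⊤)
  | k + 1 =>
    (Submodule.span ℂ {z | ∃ x u, u ∈ (lcs μ ρ β k).1 ∧ z = μ x u} ⊔
       Submodule.span ℂ {z | ∃ h v, v ∈ (lcs μ ρ β k).2 ∧ z = β h v},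
     Submodule.span ℂ {z | ∃ x v, v ∈ (lcs μ ρ β k).2 ∧ z = ρ x v} ⊔
       Submodule.span ℂ {z | ∃ u h, u ∈ (lcs μ ρ β k).1 ∧ z = ρ u h})

/-- A law is nilpotent if its lower central series vanishes at some stage. -/
def IsNilpotentLaw (μ : W0 →ₗ[ℂ] W0 →ₗ[ℂ] W0) (ρ : W0 →ₗ[ℂ] W1 →ₗ[ℂ] W1)
    (β : W1 →ₗ[ℂ] W1 →ₗ[ℂ] W0) : Prop :=
  ∃ N, (lcs μ ρ β N).1 = ⊥ ∧ (lcs μ ρ β N).2 = ⊥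

/-- A filiform Lie superalgebra law of super-nilindex `(n, m)`. -/
def IsFiliform (n m : ℕ) (μ : W0 →ₗ[ℂ] W0 →ₗ[ℂ] W0) (ρ : W0 →ₗ[ℂ] W1 →ₗ[ℂ] W1)
    (β : W1 →ₗ[ℂ] W1 →ₗ[ℂ] W0) : Prop :=
  IsSuperLaw μ ρ β ∧ IsNilpotentLaw μ ρ β ∧
  Ceven μ n = ⊥ ∧ Ceven μ (n - 1) ≠ ⊥ ∧ Codd ρ m = ⊥ ∧ Codd ρ (m - 1) ≠ ⊥

end Abstract

section NilpotentActions

open Submodule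

variable {W0 W1 V : Type} [AddCommGroup W0] [Module ℂ W0] [AddCommGroup W1] [Module ℂ W1]
  [AddCommGroup V] [Module ℂ V]

lemma Ceven_succ (μ : W0 →ₗ[ℂ] W0 →ₗ[ℂ] W0) (k : ℕ) :
    Ceven μ (k + 1) = map₂ μ ⊤ (Ceven μ k) := by
  rw [Ceven, map₂_eq_span_image2]
  congr 1
  ext z
  simp [Set.mem_image2, eq_comm]

lemma Codd_succ (ρ : W0 →ₗ[ℂ] W1 →ₗ[ℂ] W1) (k : ℕ) :
    Codd ρ (k + 1) = map₂ ρ ⊤ (Codd ρ k) := by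
  rw [Codd, map₂_eq_span_image2]
  congr 1
  ext z
  simp [Set.mem_image2, eq_comm]

/-- A subspace generated by its own image under a nilpotent action vanishes. -/
lemma eq_bot_of_le_map₂_of_Codd_eq_bot {ρ : W0 →ₗ[ℂ] W1 →ₗ[ℂ] W1} {q : ℕ}
    (hq : Codd ρ q = ⊥) {S : Submodule ℂ W1} (hS : S ≤ map₂ ρ ⊤ S) : S = ⊥ := by
  have h : ∀ k, S ≤ Codd ρ k := by
    intro k
    induction k with
    | zero => exact le_top
    | succ k ih =>
      rw [Codd_succ]
      exact hS.trans (map₂_le_map₂_right ih)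
  exact le_bot_iff.mp (hq ▸ h q)

/-- A stable subspace that is not generated by its own image contains a stable hyperplane
which, together with one vector, spans it. -/
lemma exists_stable_hyperplane {ρ : W0 →ₗ[ℂ] W1 →ₗ[ℂ] W1} {S : Submodule ℂ W1}
    (hS : map₂ ρ ⊤ S ≤ S) (hne : ¬ S ≤ map₂ ρ ⊤ S) :
    ∃ T < S, map₂ ρ ⊤ S ≤ T ∧ ∃ h ∈ S, S ≤ T ⊔ span ℂ {h} := by
  obtain ⟨h, hhS, hh⟩ := SetLike.not_le_iff_exists.mp hne
  obtain ⟨f, hf, hle⟩ := exists_le_ker_of_notMem hh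
  refine ⟨S ⊓ LinearMap.ker f, lt_of_le_of_ne inf_le_left ?_, le_inf hS hle, h, hhS, ?_⟩
  · intro he
    exact hf (inf_eq_left.mp he hhS)
  · intro s hs
    refine mem_sup.mpr ⟨s - (f s / f h) • h, ⟨S.sub_mem hs (S.smul_mem _ hhS), ?_⟩,
      (f s / f h) • h, smul_mem _ _ (mem_span_singleton_self h), by simp⟩
    simp [hf]

variable {ρ : W0 →ₗ[ℂ] W1 →ₗ[ℂ] W1} {β : W1 →ₗ[ℂ] W1 →ₗ[ℂ] W0}
  {a : W0 →ₗ[ℂ] V →ₗ[ℂ] V} {b : W1 →ₗ[ℂ] V →ₗ[ℂ] V} {M : Submodule ℂ V}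

/-- A single odd operator can be discarded from a generating set of operators, because its
square is an even operator. -/
lemma le_map₂_sup_map₂_of_le_sup_span
    (hab : ∀ x h v, a x (b h v) = b (ρ x h) v + b h (a x v))
    (hbb : ∀ h h' v, b h (b h' v) + b h' (b h v) = a (β h h') v)
    (hbM : ∀ h, ∀ v ∈ M, b h v ∈ M) {S T : Submodule ℂ W1}
    (hT : map₂ ρ ⊤ S ≤ T) {h : W1} (hh : h ∈ S) (hST : S ≤ T ⊔ span ℂ {h})
    (hM : M ≤ map₂ a ⊤ M ⊔ map₂ b S M) : M ≤ map₂ a ⊤ M ⊔ map₂ b T M := by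
  set N := map₂ a ⊤ M ⊔ map₂ b T M with hN
  have haN : ∀ x, ∀ v ∈ M, a x v ∈ N := fun x v hv =>
    mem_sup_left (apply_mem_map₂ _ mem_top hv)
  have hbN : ∀ t ∈ T, ∀ v ∈ M, b t v ∈ N := fun t ht v hv =>
    mem_sup_right (apply_mem_map₂ _ ht hv)
  have hstable : N ≤ N.comap (b h) := by
    refine sup_le (map₂_le.mpr fun x _ v hv => ?_) (map₂_le.mpr fun t ht v hv => ?_)
    · have e : b h (a x v) = a x (b h v) - b (ρ x h) v := by rw [hab]; abel
      rw [mem_comap, e]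
      exact N.sub_mem (haN _ _ (hbM _ _ hv))
        (hbN _ (hT (apply_mem_map₂ _ mem_top hh)) _ hv)
    · have e : b h (b t v) = a (β h t) v - b t (b h v) := by rw [← hbb]; abel
      rw [mem_comap, e]
      exact N.sub_mem (haN _ _ hv) (hbN _ ht _ (hbM _ _ hv))
  have hsq : ∀ v ∈ M, b h (b h v) ∈ N := by
    intro v hv
    have e : b h (b h v) = (2⁻¹ : ℂ) • a (β h h) v := by
      rw [← hbb, ← two_smul ℂ, smul_smul]
      norm_num
    rw [e]
    exact N.smul_mem _ (haN _ _ hv)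
  have hMN : M ≤ N ⊔ M.map (b h) := by
    refine hM.trans (sup_le (le_sup_left.trans le_sup_left) (map₂_le.mpr fun s hs v hv => ?_))
    obtain ⟨t, ht, c, hc, rfl⟩ := mem_sup.mp (hST hs)
    obtain ⟨r, rfl⟩ := mem_span_singleton.mp hc
    rw [map_add, LinearMap.add_apply, map_smul, LinearMap.smul_apply]
    exact add_mem (mem_sup_left (hbN _ ht _ hv))
      (smul_mem _ _ (mem_sup_right (mem_map_of_mem hv)))
  have hbhM : M.map (b h) ≤ N := by
    rw [map_le_iff_le_comap]
    refine hMN.trans (sup_le hstable ?_)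
    rintro _ ⟨v, hv, rfl⟩
    exact hsq v hv
  exact hMN.trans (sup_le le_rfl hbhM)

/-- If the even part acts nilpotently on the odd part, a subspace generated by its images under
all operators is already generated by its images under the even ones. -/
lemma le_map₂_of_le_map₂_sup_map₂ [FiniteDimensional ℂ W1]
    (hab : ∀ x h v, a x (b h v) = b (ρ x h) v + b h (a x v))
    (hbb : ∀ h h' v, b h (b h' v) + b h' (b h v) = a (β h h') v)
    (hbM : ∀ h, ∀ v ∈ M, b h v ∈ M) {q : ℕ} (hq : Codd ρ q = ⊥)
    (hM : M ≤ map₂ a ⊤ M ⊔ map₂ b ⊤ M) : M ≤ map₂ a ⊤ M := by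
  suffices H : ∀ S : Submodule ℂ W1, map₂ ρ ⊤ S ≤ S →
      M ≤ map₂ a ⊤ M ⊔ map₂ b S M → M ≤ map₂ a ⊤ M from H ⊤ le_top hM
  intro S
  induction S using WellFoundedLT.induction with
  | ind S ih =>
    intro hS hMS
    by_cases hle : S ≤ map₂ ρ ⊤ S
    · rw [eq_bot_of_le_map₂_of_Codd_eq_bot hq hle] at hMS
      simpa using hMS
    · obtain ⟨T, hTS, hT, h, hh, hST⟩ := exists_stable_hyperplane hS hle
      exact ih T hTS ((map₂_le_map₂_right hTS.le).trans hT)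
        (le_map₂_sup_map₂_of_le_sup_span hab hbb hbM hT hh hST hMS)

end NilpotentActions

section Adjoint

open Submodule

variable {W0 W1 : Type} [AddCommGroup W0] [Module ℂ W0] [AddCommGroup W1] [Module ℂ W1]

/-- The adjoint action of the even part on `W0 × W1`. -/
def adEven (μ : W0 →ₗ[ℂ] W0 →ₗ[ℂ] W0) (ρ : W0 →ₗ[ℂ] W1 →ₗ[ℂ] W1) :
    W0 →ₗ[ℂ] (W0 × W1) →ₗ[ℂ] (W0 × W1) :=
  LinearMap.mk₂ ℂ (fun x v => (μ x v.1, ρ x v.2)) (by simp) (by simp) (by simp) (by simp)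

/-- The adjoint action of the odd part on `W0 × W1`. -/
def adOdd (ρ : W0 →ₗ[ℂ] W1 →ₗ[ℂ] W1) (β : W1 →ₗ[ℂ] W1 →ₗ[ℂ] W0) :
    W1 →ₗ[ℂ] (W0 × W1) →ₗ[ℂ] (W0 × W1) :=
  LinearMap.mk₂ ℂ (fun h v => (β h v.2, -ρ v.1 h)) (by simp [add_comm]) (by simp)
    (by simp [add_comm]) (by simp)

variable {μ : W0 →ₗ[ℂ] W0 →ₗ[ℂ] W0} {ρ : W0 →ₗ[ℂ] W1 →ₗ[ℂ] W1}
  {β : W1 →ₗ[ℂ] W1 →ₗ[ℂ] W0}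

@[simp] lemma adEven_apply (x : W0) (v : W0 × W1) :
    adEven μ ρ x v = (μ x v.1, ρ x v.2) := rfl

@[simp] lemma adOdd_apply (h : W1) (v : W0 × W1) :
    adOdd ρ β h v = (β h v.2, -ρ v.1 h) := rfl

lemma IsSuperLaw.skew (hlaw : IsSuperLaw μ ρ β) (x y : W0) : μ x y = -μ y x := by
  have h := hlaw.1 (x + y)
  simp only [map_add, LinearMap.add_apply, hlaw.1, zero_add, add_zero] at h
  rw [add_comm] at h
  exact eq_neg_of_add_eq_zero_left h

lemma IsSuperLaw.adEven_adOdd (hlaw : IsSuperLaw μ ρ β) (x : W0) (h : W1) (v : W0 × W1) :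
    adEven μ ρ x (adOdd ρ β h v) = adOdd ρ β (ρ x h) v + adOdd ρ β h (adEven μ ρ x v) := by
  obtain ⟨-, hβ, -, hρ, hμβ, -⟩ := hlaw
  ext
  · simp [hμβ, hβ h (ρ x v.2)]
  · simp [hρ]
    abel

lemma IsSuperLaw.adOdd_adOdd (hlaw : IsSuperLaw μ ρ β) (h h' : W1) (v : W0 × W1) :
    adOdd ρ β h (adOdd ρ β h' v) + adOdd ρ β h' (adOdd ρ β h v) =
      adEven μ ρ (β h h') v := by
  have hskew := hlaw.skew (β h h') v.1
  obtain ⟨-, hβ, -, -, hμβ, hJ⟩ := hlaw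
  ext
  · simp only [adOdd_apply, adEven_apply, Prod.fst_add, map_neg, hskew, hμβ, hβ h (ρ v.1 h'),
      hβ h' (ρ v.1 h)]
    abel
  · have := hJ h h' v.2
    rw [hβ v.2 h] at this
    simp only [adOdd_apply, adEven_apply, Prod.snd_add]
    rw [← sub_eq_zero, ← neg_eq_zero, ← this]
    abel

variable (μ ρ β) in
/-- The lower central series, as a sequence of subspaces of `W0 × W1`. -/
def lcsProd : ℕ → Submodule ℂ (W0 × W1)
  | 0 => ⊤
  | k + 1 => map₂ (adEven μ ρ) ⊤ (lcsProd k) ⊔ map₂ (adOdd ρ β) ⊤ (lcsProd k)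

lemma lcsProd_antitone : Antitone (lcsProd μ ρ β) := by
  refine antitone_nat_of_succ_le fun k => ?_
  induction k with
  | zero => exact le_top
  | succ k ih => exact sup_le_sup (map₂_le_map₂_right ih) (map₂_le_map₂_right ih)

lemma lcs_le_comap_lcsProd (k : ℕ) :
    (lcs μ ρ β k).1 ≤ (lcsProd μ ρ β k).comap (LinearMap.inl ℂ W0 W1) ∧
      (lcs μ ρ β k).2 ≤ (lcsProd μ ρ β k).comap (LinearMap.inr ℂ W0 W1) := by
  induction k with
  | zero => simp [lcsProd]
  | succ k ih =>
    obtain ⟨ih0, ih1⟩ := ih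
    have ha : ∀ x, ∀ v ∈ lcsProd μ ρ β k, adEven μ ρ x v ∈ lcsProd μ ρ β (k + 1) :=
      fun x v hv => mem_sup_left (apply_mem_map₂ _ mem_top hv)
    have hb : ∀ h, ∀ v ∈ lcsProd μ ρ β k, adOdd ρ β h v ∈ lcsProd μ ρ β (k + 1) :=
      fun h v hv => mem_sup_right (apply_mem_map₂ _ mem_top hv)
    refine ⟨sup_le (span_le.mpr ?_) (span_le.mpr ?_), sup_le (span_le.mpr ?_) (span_le.mpr ?_)⟩
    · rintro _ ⟨x, u, hu, rfl⟩
      simpa using ha x _ (ih0 hu)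
    · rintro _ ⟨h, v, hv, rfl⟩
      simpa using hb h _ (ih1 hv)
    · rintro _ ⟨x, v, hv, rfl⟩
      simpa using ha x _ (ih1 hv)
    · rintro _ ⟨u, h, hu, rfl⟩
      simpa using neg_mem (hb h _ (ih0 hu))

lemma Ceven_le_lcs (k : ℕ) : Ceven μ k ≤ (lcs μ ρ β k).1 := by
  induction k with
  | zero => exact le_top
  | succ k ih =>
    refine (span_mono ?_).trans le_sup_left
    rintro _ ⟨x, u, hu, rfl⟩
    exact ⟨x, u, ih hu, rfl⟩

lemma Codd_le_lcs (k : ℕ) : Codd ρ k ≤ (lcs μ ρ β k).2 := by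
  induction k with
  | zero => exact le_top
  | succ k ih =>
    refine (span_mono ?_).trans le_sup_left
    rintro _ ⟨x, v, hv, rfl⟩
    exact ⟨x, v, ih hv, rfl⟩

lemma Ceven_antitone : Antitone (Ceven μ) := by
  refine antitone_nat_of_succ_le fun k => ?_
  induction k with
  | zero => exact le_top
  | succ k ih =>
    rw [Ceven_succ μ (k + 1)]
    exact (map₂_le_map₂_right ih).trans_eq (Ceven_succ μ k).symm

lemma Codd_antitone : Antitone (Codd ρ) := by
  refine antitone_nat_of_succ_le fun k => ?_
  induction k with
  | zero => exact le_top
  | succ k ih =>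
    rw [Codd_succ ρ (k + 1)]
    exact (map₂_le_map₂_right ih).trans_eq (Codd_succ ρ k).symm

/-- A subspace of `W0 × W1` generated by its images under the even operators vanishes when both
even series do. -/
lemma eq_bot_of_le_map₂_adEven {p q : ℕ} (hp : Ceven μ p = ⊥) (hq : Codd ρ q = ⊥)
    {M : Submodule ℂ (W0 × W1)} (hM : M ≤ map₂ (adEven μ ρ) ⊤ M) : M = ⊥ := by
  have h : ∀ k, M ≤ (Ceven μ k).prod (Codd ρ k) := by
    intro k
    induction k with
    | zero => simp [Ceven, Codd]
    | succ k ih =>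
      refine hM.trans (map₂_le.mpr fun x _ v hv => ?_)
      rw [Ceven_succ, Codd_succ]
      exact ⟨apply_mem_map₂ _ mem_top (ih hv).1, apply_mem_map₂ _ mem_top (ih hv).2⟩
  have hp' : Ceven μ (max p q) = ⊥ :=
    le_bot_iff.mp ((Ceven_antitone (le_max_left p q)).trans hp.le)
  have hq' : Codd ρ (max p q) = ⊥ :=
    le_bot_iff.mp ((Codd_antitone (le_max_right p q)).trans hq.le)
  simpa [hp', hq'] using h (max p q)

end Adjoint

theorem nilpotent_iff_even_and_odd_series_vanish
    {W0 W1 : Type} [AddCommGroup W0] [Module ℂ W0] [FiniteDimensional ℂ W0]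
    [AddCommGroup W1] [Module ℂ W1] [FiniteDimensional ℂ W1]
    (μ : W0 →ₗ[ℂ] W0 →ₗ[ℂ] W0) (ρ : W0 →ₗ[ℂ] W1 →ₗ[ℂ] W1) (β : W1 →ₗ[ℂ] W1 →ₗ[ℂ] W0)
    (hlaw : IsSuperLaw μ ρ β) :
    IsNilpotentLaw μ ρ β ↔ ∃ p q : ℕ, Ceven μ p = ⊥ ∧ Codd ρ q = ⊥ := by
  constructor
  · rintro ⟨N, h0, h1⟩
    exact ⟨N, N, le_bot_iff.mp ((Ceven_le_lcs N).trans h0.le),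
      le_bot_iff.mp ((Codd_le_lcs N).trans h1.le)⟩
  · rintro ⟨p, q, hp, hq⟩
    obtain ⟨n, hn⟩ := IsArtinian.monotone_stabilizes
      (⟨fun k => OrderDual.toDual (lcsProd μ ρ β k), fun _ _ h => lcsProd_antitone h⟩ :
        ℕ →o (Submodule ℂ (W0 × W1))ᵒᵈ)
    have hstab : lcsProd μ ρ β n = lcsProd μ ρ β (n + 1) := hn (n + 1) n.le_succ
    have hstable : ∀ h, ∀ v ∈ lcsProd μ ρ β n, adOdd ρ β h v ∈ lcsProd μ ρ β n := by
      intro h v hv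
      rw [hstab]
      exact Submodule.mem_sup_right (Submodule.apply_mem_map₂ _ Submodule.mem_top hv)
    have hbot : lcsProd μ ρ β n = ⊥ :=
      eq_bot_of_le_map₂_adEven hp hq
        (le_map₂_of_le_map₂_sup_map₂ hlaw.adEven_adOdd hlaw.adOdd_adOdd hstable hq hstab.le)
    obtain ⟨h0, h1⟩ := lcs_le_comap_lcsProd (μ := μ) (ρ := ρ) (β := β) n
    rw [hbot] at h0 h1
    refine ⟨n, (Submodule.eq_bot_iff _).mpr fun u hu => ?_,
      (Submodule.eq_bot_iff _).mpr fun v hv => ?_⟩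
    · simpa using h0 hu
    · simpa using h1 hv

end
end

section
/- Fix integers n ≥ 1 and m ≥ 1. Let (ψ, ρ, b) be an even 2-cocycle of L_{n,m} such that the triple (μ0 + ψ, ρ0 + ρ, b) is a nilpotent Lie superalgebra law on (V0, V1). Then ρ0(ψ(g, g′), h) = 0 for all g, g′ ∈ V0 and h ∈ V1, and consequently: ψ satisfies the Lie-algebra 2-cocycle identity (E1) of the filiform Lie algebra L_n (the even part of L_{n,m}); ρ is a ρ-cocycle of L_{n,m}; and b is a b-cocycle of L_{n,m}. -/
open Finset

noncomputable section

/-- The even part of `L_{n,m}`: `ℂ^{n+1}` with basis `X_0, …, X_n`. -/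
abbrev V0 (n : ℕ) : Type := Fin (n + 1) → ℂ

/-- The odd part of `L_{n,m}`: `ℂ^m` with basis `Y_1, …, Y_m`. -/
abbrev V1 (m : ℕ) : Type := Fin m → ℂ

/-- Basis vector `X_k` of `V0 n` for `0 ≤ k ≤ n`; zero for `k > n`. -/
def Xb (n k : ℕ) : V0 n := if h : k ≤ n then Pi.single (⟨k, by omega⟩ : Fin (n + 1)) 1 else 0

/-- `X_k`, with the convention that it denotes the zero vector for `k ≤ 0` or `k > n`. -/
def Xz (n : ℕ) (k : ℤ) : V0 n :=
  if h : 1 ≤ k ∧ k ≤ n then Pi.single (⟨k.toNat, by omega⟩ : Fin (n + 1)) 1 else 0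

/-- Basis vector `Y_k` of `V1 m` for `1 ≤ k ≤ m`; zero otherwise. -/
def Yb (m k : ℕ) : V1 m :=
  if h : 1 ≤ k ∧ k ≤ m then Pi.single (⟨k - 1, by omega⟩ : Fin m) 1 else 0

/-- The bilinear map determined by its values on the standard bases. -/
def bil {ι κ : Type} [Fintype ι] [DecidableEq ι] [Fintype κ] [DecidableEq κ]
    {M : Type} [AddCommGroup M] [Module ℂ M] (f : ι → κ → M) :
    (ι → ℂ) →ₗ[ℂ] (κ → ℂ) →ₗ[ℂ] M :=
  LinearMap.mk₂ ℂ (fun x y => ∑ i, ∑ j, (x i * y j) • f i j)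
    (fun x x' y => by simp [add_mul, add_smul, Finset.sum_add_distrib])
    (fun c x y => by simp [Finset.smul_sum, mul_assoc, mul_smul])
    (fun x y y' => by simp [mul_add, add_smul, Finset.sum_add_distrib])
    (fun c x y => by simp [Finset.smul_sum, mul_smul, mul_left_comm])

/-- The bracket `μ0` of `L_{n,m}` on the even part. -/
def mu0 (n : ℕ) : V0 n →ₗ[ℂ] V0 n →ₗ[ℂ] V0 n :=
  bil fun i j =>
    if (i : ℕ) = 0 ∧ 1 ≤ (j : ℕ) then Xz n (((j : ℕ) : ℤ) + 1)
    else if (j : ℕ) = 0 ∧ 1 ≤ (i : ℕ) then -Xz n (((i : ℕ) : ℤ) + 1)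
    else 0

/-- The bracket `ρ0` of `L_{n,m}` between the even and the odd part. -/
def rho0 (n m : ℕ) : V0 n →ₗ[ℂ] V1 m →ₗ[ℂ] V1 m :=
  bil fun i j => if (i : ℕ) = 0 then Yb m ((j : ℕ) + 2) else 0


/-- Pinned instance for the space of bilinear maps `V0 × V1 → V1`. -/
instance (priority := 5000) instAddCommGroupBilRho (n m : ℕ) :
    AddCommGroup (V0 n →ₗ[ℂ] V1 m →ₗ[ℂ] V1 m) := LinearMap.addCommGroup

/-- Pinned instance for the space of bilinear maps `V0 × V1 → V1`. -/
instance (priority := 5000) instModuleBilRho (n m : ℕ) :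
    Module ℂ (V0 n →ₗ[ℂ] V1 m →ₗ[ℂ] V1 m) := LinearMap.module

/-- Pinned instance for the space of bilinear maps `V1 × V1 → V0`. -/
instance (priority := 5000) instAddCommGroupBilB (n m : ℕ) :
    AddCommGroup (V1 m →ₗ[ℂ] V1 m →ₗ[ℂ] V0 n) := LinearMap.addCommGroup

/-- Pinned instance for the space of bilinear maps `V1 × V1 → V0`. -/
instance (priority := 5000) instModuleBilB (n m : ℕ) :
    Module ℂ (V1 m →ₗ[ℂ] V1 m →ₗ[ℂ] V0 n) := LinearMap.module
/-- `ρ` is a ρ-cocycle of `L_{n,m}`. -/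
def IsRhoCocycle (n m : ℕ) (ρ : V0 n →ₗ[ℂ] V1 m →ₗ[ℂ] V1 m) : Prop :=
  ∀ (g g' : V0 n) (h : V1 m),
    ρ (mu0 n g g') h + ρ g' (rho0 n m g h) - ρ g (rho0 n m g' h)
      - rho0 n m g (ρ g' h) + rho0 n m g' (ρ g h) = 0

/-- `b` is a b-cocycle of `L_{n,m}` : it is symmetric and satisfies (R1) and (R2). -/
def IsBCocycle (n m : ℕ) (b : V1 m →ₗ[ℂ] V1 m →ₗ[ℂ] V0 n) : Prop :=
  (∀ h h', b h h' = b h' h) ∧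
  (∀ (g : V0 n) (h h' : V1 m),
    b (rho0 n m g h) h' + b (rho0 n m g h') h - mu0 n g (b h h') = 0) ∧
  (∀ h h' h'' : V1 m,
    rho0 n m (b h h') h'' + rho0 n m (b h'' h') h + rho0 n m (b h'' h) h' = 0)

/-- `b` satisfies relation (R3). -/
def SatR3 (n m : ℕ) (b : V1 m →ₗ[ℂ] V1 m →ₗ[ℂ] V0 n) : Prop :=
  ∀ t r : ℕ, 1 ≤ t → t ≤ m - 1 → 1 ≤ r → r ≤ m - 1 →
    mu0 n (Xb n 0) (b (Yb m t) (Yb m r)) = b (Yb m (t + 1)) (Yb m r) + b (Yb m (r + 1)) (Yb m t)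

/-- Membership in the space `E`: symmetric, satisfies (R3), and `b(Y_m,Y_m) ∈ ℂ·X_n`. -/
def MemE (n m : ℕ) (b : V1 m →ₗ[ℂ] V1 m →ₗ[ℂ] V0 n) : Prop :=
  (∀ h h', b h h' = b h' h) ∧ SatR3 n m b ∧ ∃ c : ℂ, b (Yb m m) (Yb m m) = c • Xb n n
/-- `(ψ, ρ, b)` is an even 2-cocycle of `L_{n,m}`. -/
def IsEvenCocycle (n m : ℕ) (ψ : V0 n →ₗ[ℂ] V0 n →ₗ[ℂ] V0 n)
    (ρ : V0 n →ₗ[ℂ] V1 m →ₗ[ℂ] V1 m) (b : V1 m →ₗ[ℂ] V1 m →ₗ[ℂ] V0 n) : Prop :=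
  (∀ x, ψ x x = 0) ∧ (∀ h h', b h h' = b h' h) ∧
  (∀ g g' g'', ψ (mu0 n g g') g'' - ψ (mu0 n g g'') g' + ψ (mu0 n g' g'') g
     - mu0 n g (ψ g' g'') + mu0 n g' (ψ g g'') - mu0 n g'' (ψ g g') = 0) ∧
  (∀ g g' h, ρ (mu0 n g g') h + ρ g' (rho0 n m g h) - ρ g (rho0 n m g' h)
     - rho0 n m g (ρ g' h) + rho0 n m g' (ρ g h) - rho0 n m (ψ g g') h = 0) ∧
  (∀ g h h', b (rho0 n m g h) h' + b (rho0 n m g h') h - mu0 n g (b h h') = 0) ∧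
  (∀ h h' h'', rho0 n m (b h h') h'' + rho0 n m (b h'' h') h + rho0 n m (b h'' h) h' = 0)

/-- The filtration `S^0_k = span{X_k, …, X_n}`. -/
def S0 (n k : ℕ) : Submodule ℂ (V0 n) :=
  Submodule.span ℂ {z | ∃ i : ℕ, k ≤ i ∧ i ≤ n ∧ z = Xb n i}

/-- The filtration `S^1_k = span{Y_k, …, Y_m}`. -/
def S1 (m k : ℕ) : Submodule ℂ (V1 m) :=
  Submodule.span ℂ {z | ∃ i : ℕ, k ≤ i ∧ i ≤ m ∧ z = Yb m i}

/-- The even bracket `μ0` takes values in the span of `X_1, …, X_n`. -/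
theorem mu0_apply_zero (n : ℕ) (x y : V0 n) : mu0 n x y 0 = 0 := by
  have hX (k : ℤ) : Xz n k 0 = 0 := by
    unfold Xz
    split_ifs with h
    · refine Pi.single_eq_of_ne (fun h0 => ?_) _
      have := congrArg Fin.val h0
      simp only [Fin.val_zero] at this
      omega
    · rfl
  simp only [mu0, bil, LinearMap.mk₂_apply, Finset.sum_apply, Pi.smul_apply]
  refine Finset.sum_eq_zero fun i _ => Finset.sum_eq_zero fun j _ => ?_
  split_ifs <;> simp [hX]

/-- The span of `X_1, …, X_n` is abelian for `μ0`. -/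
theorem mu0_eq_zero_of_apply_zero (n : ℕ) {x y : V0 n} (hx : x 0 = 0) (hy : y 0 = 0) :
    mu0 n x y = 0 := by
  simp only [mu0, bil, LinearMap.mk₂_apply]
  refine Finset.sum_eq_zero fun i _ => Finset.sum_eq_zero fun j _ => ?_
  rcases eq_or_ne i 0 with rfl | hi
  · simp [hx]
  rcases eq_or_ne j 0 with rfl | hj
  · simp [hy]
  have hi' : (i : ℕ) ≠ 0 := fun h => hi (Fin.ext h)
  have hj' : (j : ℕ) ≠ 0 := fun h => hj (Fin.ext h)
  simp [hi', hj']

/-- The action `ρ0` only sees the `X_0`-coordinate. -/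
theorem rho0_apply_eq_smul (n m : ℕ) (g : V0 n) (h : V1 m) :
    rho0 n m g h = g 0 • ∑ j : Fin m, h j • Yb m ((j : ℕ) + 2) := by
  simp only [rho0, bil, LinearMap.mk₂_apply]
  rw [Finset.sum_eq_single 0]
  · simp [Finset.smul_sum, mul_smul]
  · intro i _ hi
    have hi' : (i : ℕ) ≠ 0 := fun h => hi (Fin.ext h)
    simp [hi']
  · simp

/-- Iterated even brackets lie in the lower central series. -/
theorem iterate_mem_lcs {W0 W1 : Type} [AddCommGroup W0] [Module ℂ W0] [AddCommGroup W1]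
    [Module ℂ W1] (μ : W0 →ₗ[ℂ] W0 →ₗ[ℂ] W0) (ρ : W0 →ₗ[ℂ] W1 →ₗ[ℂ] W1)
    (β : W1 →ₗ[ℂ] W1 →ₗ[ℂ] W0) (g x : W0) (k : ℕ) : (μ g)^[k] x ∈ (lcs μ ρ β k).1 := by
  induction k with
  | zero => exact Submodule.mem_top
  | succ k ih =>
    rw [Function.iterate_succ_apply']
    exact Submodule.mem_sup_left (Submodule.subset_span ⟨g, _, ih, rfl⟩)

/-- If `μ0 + ψ` is the even bracket of a nilpotent law and `ψ` maps pairs of elements of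
`span{X_1, …, X_n}` into that span, then all values of `ψ` lie in it. -/
theorem cochain_apply_zero_of_nilpotent {n m : ℕ} {ψ : V0 n →ₗ[ℂ] V0 n →ₗ[ℂ] V0 n}
    {ρ : V0 n →ₗ[ℂ] V1 m →ₗ[ℂ] V1 m} {b : V1 m →ₗ[ℂ] V1 m →ₗ[ℂ] V0 n}
    (halt : ∀ x, ψ x x = 0) (hnil : IsNilpotentLaw (mu0 n + ψ) ρ b)
    (hψ : ∀ x y : V0 n, x 0 = 0 → y 0 = 0 → ψ x y 0 = 0) (x y : V0 n) : ψ x y 0 = 0 := by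
  obtain ⟨e, he⟩ : ∃ e : V0 n, e 0 = 1 := ⟨Pi.single 0 1, by simp⟩
  have hdec (z : V0 n) : ∃ z' : V0 n, z' 0 = 0 ∧ z = z 0 • e + z' :=
    ⟨z - z 0 • e, by simp [he], by simp⟩
  have hscale (g : V0 n) (hg : g 0 = 0) (z : V0 n) : ψ g z 0 = ψ g e 0 * z 0 := by
    obtain ⟨z', hz', hz⟩ := hdec z
    have h := congrArg (fun w => ψ g w 0) hz
    simpa [hψ g z' hg hz', mul_comm] using h
  have hvanish (g : V0 n) (hg : g 0 = 0) : ψ g e 0 = 0 := by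
    have hiter (k : ℕ) : ((mu0 n + ψ) g)^[k] e 0 = ψ g e 0 ^ k := by
      induction k with
      | zero => simp [he]
      | succ k ih =>
        have hstep (z : V0 n) : (mu0 n + ψ) g z 0 = ψ g e 0 * z 0 := by
          simp [mu0_apply_zero, hscale g hg z]
        rw [Function.iterate_succ_apply', hstep, ih, pow_succ']
    obtain ⟨N, hN, -⟩ := hnil
    have hmem := iterate_mem_lcs (mu0 n + ψ) ρ b g e N
    rw [hN, Submodule.mem_bot] at hmem
    have hpow := hiter N
    rw [hmem] at hpow
    exact eq_zero_of_pow_eq_zero hpow.symm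
  have hneg (u v : V0 n) : ψ u v = -ψ v u := by
    have h := halt (u + v)
    simp only [map_add, LinearMap.add_apply, halt, zero_add, add_zero] at h
    rw [add_comm] at h
    exact eq_neg_of_add_eq_zero_left h
  obtain ⟨x', hx', hx⟩ := hdec x
  obtain ⟨y', hy', hy⟩ := hdec y
  have hey : ψ e y 0 = 0 := by
    rw [hy, map_add, map_smul, halt, hneg e y']
    simp [hvanish y' hy']
  rw [hx, map_add, map_smul]
  simp [hey, hscale x' hx' y, hvanish x' hx']

/-- If `(ψ, ρ, b)` is an even 2-cocycle of `L_{n,m}` such that `(μ0 + ψ, ρ0 + ρ, b)` is a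
nilpotent Lie superalgebra law, then `ρ0(ψ(g,g'), h) = 0`; consequently `ψ` satisfies the
Lie-algebra cocycle identity (E1), `ρ` is a ρ-cocycle and `b` is a b-cocycle of `L_{n,m}`. -/
theorem even_cocycle_of_nilpotent_deformation_decomposes (n m : ℕ) (hn : 1 ≤ n) (hm : 1 ≤ m)
    (ψ : V0 n →ₗ[ℂ] V0 n →ₗ[ℂ] V0 n) (ρ : V0 n →ₗ[ℂ] V1 m →ₗ[ℂ] V1 m)
    (b : V1 m →ₗ[ℂ] V1 m →ₗ[ℂ] V0 n)
    (hcoc : IsEvenCocycle n m ψ ρ b)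
    (hlaw : IsSuperLaw (mu0 n + ψ) (rho0 n m + ρ) b)
    (hnil : IsNilpotentLaw (mu0 n + ψ) (rho0 n m + ρ) b) :
    (∀ (g g' : V0 n) (h : V1 m), rho0 n m (ψ g g') h = 0) ∧
    (∀ g g' g'' : V0 n,
      ψ (mu0 n g g') g'' - ψ (mu0 n g g'') g' + ψ (mu0 n g' g'') g
        - mu0 n g (ψ g' g'') + mu0 n g' (ψ g g'') - mu0 n g'' (ψ g g') = 0) ∧
    IsRhoCocycle n m ρ ∧ IsBCocycle n m b := by
  obtain ⟨halt, hsymm, hE1, hE2, hE3, hE4⟩ := hcoc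
  have key : ∀ (g g' : V0 n) (h : V1 m), rho0 n m (ψ g g') h = 0 := by
    intro g g' h
    by_contra hne
    rw [rho0_apply_eq_smul] at hne
    obtain ⟨hg, hT⟩ := smul_ne_zero_iff.mp hne
    refine hg (cochain_apply_zero_of_nilpotent halt hnil (fun x y hx hy => ?_) g g')
    have h2 := hE2 x y h
    simp only [mu0_eq_zero_of_apply_zero n hx hy, rho0_apply_eq_smul, hx, hy, zero_smul,
      map_zero, LinearMap.zero_apply, add_zero, sub_zero, zero_sub, neg_eq_zero] at h2
    exact (smul_eq_zero.mp h2).resolve_right hT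
  refine ⟨key, hE1, fun g g' h => ?_, hsymm, hE3, hE4⟩
  simpa only [key, sub_zero] using hE2 g g' h

end
end

section
/- Fix integers n ≥ 1 and m ≥ 1. Let b : V1 × V1 → V0 be a symmetric bilinear map satisfying relation (R3), and suppose b(Y_i, Y_i) = 0 for all 1 ≤ i ≤ m. Then b = 0. -/
open Finset

noncomputable section

/-- Under (R3), a symmetric `b` vanishing on the diagonal vanishes on all pairs of basis vectors
`(Y_i, Y_{i+d})`. -/
theorem SatR3.apply_Yb_add_eq_zero {n m : ℕ} {b : V1 m →ₗ[ℂ] V1 m →ₗ[ℂ] V0 n}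
    (hsym : ∀ h h', b h h' = b h' h) (hR3 : SatR3 n m b)
    (hdiag : ∀ i : ℕ, 1 ≤ i → i ≤ m → b (Yb m i) (Yb m i) = 0) (d : ℕ) :
    ∀ i : ℕ, 1 ≤ i → i + d ≤ m → b (Yb m i) (Yb m (i + d)) = 0 := by
  induction d using Nat.twoStepInduction with
  | zero => exact hdiag
  | one =>
    intro i hi him
    have h := hR3 i i hi (by omega) hi (by omega)
    rw [hdiag i hi (by omega), map_zero, ← two_smul ℂ, eq_comm, smul_eq_zero] at h
    rw [hsym]
    exact h.resolve_left two_ne_zero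
  | more d ih ih' =>
    intro i hi him
    have h := hR3 i (i + (d + 1)) hi (by omega) (by omega) (by omega)
    have h' := ih (i + 1) (by omega) (by omega)
    rw [show i + 1 + d = i + (d + 1) by omega] at h'
    rw [ih' i hi (by omega), map_zero, h', zero_add] at h
    rw [hsym]
    exact h.symm

theorem Yb_val_add_one {m : ℕ} (i : Fin m) : Yb m (i + 1) = Pi.single i 1 := by
  simp [Yb]

/-- A symmetric bilinear map satisfying (R3) which vanishes on the diagonal values
`(Y_i, Y_i)` is identically zero. -/
theorem symm_R3_diag_zero_eq_zero (n m : ℕ) (hn : 1 ≤ n) (hm : 1 ≤ m)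
    (b : V1 m →ₗ[ℂ] V1 m →ₗ[ℂ] V0 n)
    (hsym : ∀ h h', b h h' = b h' h) (hR3 : SatR3 n m b)
    (hdiag : ∀ i : ℕ, 1 ≤ i → i ≤ m → b (Yb m i) (Yb m i) = 0) :
    b = 0 := by
  have key : ∀ i j : Fin m, i ≤ j → b (Pi.single i 1) (Pi.single j 1) = 0 := by
    intro i j hij
    have hij' : (i : ℕ) ≤ j := hij
    have h := hR3.apply_Yb_add_eq_zero hsym hdiag (j - i) (i + 1) (by omega) (by omega)
    rwa [show (i : ℕ) + 1 + (j - i) = j + 1 by omega, Yb_val_add_one, Yb_val_add_one] at h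
  refine (Pi.basisFun ℂ (Fin m)).ext fun i => (Pi.basisFun ℂ (Fin m)).ext fun j => ?_
  simp only [Pi.basisFun_apply, LinearMap.zero_apply]
  rcases le_total i j with h | h
  · exact key i j h
  · rw [hsym]
    exact key j i h

end
end

section
/- Fix integers n ≥ 3 and m ≥ 2. Let q be an integer with 1 ≤ q ≤ min(m−1, n−2), and let p be an integer with p ≥ 1 and 2 + m + q − n ≤ 2p ≤ m − q + 1, and set s = n − m − q − 1 + 2p. Then A_{p,s} is nonempty; more precisely, there exist complex numbers α_1, …, α_q such that f_{p,s} + Σ_{k=1}^{q} α_k · f_{p+k, s+2k} is a b-cocycle of L_{n,m}. -/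
open Finset

noncomputable section

/-- Extended binomial coefficient: `C(-1,-1) = 1`, `C(a,c) = 0` for `c < 0` or `c > a`
(except `C(-1,-1)`), and the usual binomial coefficient for `0 ≤ c ≤ a`. -/
def CC (a c : ℤ) : ℂ :=
  if a = -1 ∧ c = -1 then 1
  else if 0 ≤ c ∧ c ≤ a then (Nat.choose a.toNat c.toNat : ℂ) else 0

/-- The coefficient `((-1)^{p-i}/2)·(C(j-p, p-i) + C(j-p-1, p-i-1))` of `f_{p,s}`. -/
def fcoef (p i j : ℕ) : ℂ :=
  ((-1 : ℂ) ^ (p - i) / 2) *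
    (CC ((j : ℤ) - p) ((p : ℤ) - i) + CC ((j : ℤ) - p - 1) ((p : ℤ) - i - 1))

/-- The symmetric bilinear maps `f_{p,s} : V1 × V1 → V0`. -/
def fps (n m p s : ℕ) : V1 m →ₗ[ℂ] V1 m →ₗ[ℂ] V0 n :=
  if p = m ∧ s = n then
    bil fun i' j' => if (i' : ℕ) + 1 = m ∧ (j' : ℕ) + 1 = m then Xb n n else 0
  else if 1 ≤ p ∧ p ≤ m - 1 ∧ 1 ≤ s ∧ s ≤ n then
    bil fun i' j' =>
      if (i' : ℕ) + 1 ≤ p ∧ p ≤ (j' : ℕ) + 1 then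
        fcoef p ((i' : ℕ) + 1) ((j' : ℕ) + 1) •
          Xz n ((s : ℤ) - 2 * p + ((i' : ℕ) + 1) + ((j' : ℕ) + 1))
      else if (j' : ℕ) + 1 ≤ p ∧ p ≤ (i' : ℕ) + 1 then
        fcoef p ((j' : ℕ) + 1) ((i' : ℕ) + 1) •
          Xz n ((s : ℤ) - 2 * p + ((i' : ℕ) + 1) + ((j' : ℕ) + 1))
      else 0
  else 0

/-- `b_{p,s}^{(α)} := f_{p,s} + Σ_{k=1}^{m-p} α_k · f_{p+k, s+2k}`. -/
def bps (n m p s : ℕ) (α : Fin (m - p) → ℂ) : V1 m →ₗ[ℂ] V1 m →ₗ[ℂ] V0 n :=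
  fps n m p s + ∑ k : Fin (m - p), α k • fps n m (p + (k : ℕ) + 1) (s + 2 * ((k : ℕ) + 1))

/-- `A_{p,s}`: the set of tuples `α` such that `b_{p,s}^{(α)}` is a b-cocycle. -/
def Aset (n m p s : ℕ) : Set (Fin (m - p) → ℂ) := {α | IsBCocycle n m (bps n m p s α)}

/-- A b-cocycle of type `(p,s)`: one of the form `b_{p,s}^{(α)}` with `α ∈ A_{p,s}`. -/
def OfType (n m p s : ℕ) (c : V1 m →ₗ[ℂ] V1 m →ₗ[ℂ] V0 n) : Prop :=
  ∃ α ∈ Aset n m p s, c = bps n m p s α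

/-- A minimal b-cocycle of type `(p,s)`. -/
def MinimalBC (n m p s : ℕ) (c : V1 m →ₗ[ℂ] V1 m →ₗ[ℂ] V0 n) : Prop :=
  OfType n m p s c ∧
  ¬∃ (c' c'' : V1 m →ₗ[ℂ] V1 m →ₗ[ℂ] V0 n) (a : ℂ) (k : ℕ),
      1 ≤ k ∧ a ≠ 0 ∧ c'' ≠ 0 ∧ OfType n m p s c' ∧
      OfType n m (p + k) (s + 2 * k) c'' ∧ c = c' + a • c''

lemma CC_natCast (a c : ℕ) : CC a c = (a.choose c : ℂ) := by
  unfold CC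
  rw [if_neg (by omega)]
  split_ifs with h
  · simp
  · rw [Nat.choose_eq_zero_of_lt (by omega), Nat.cast_zero]

lemma CC_eq_zero_of_neg {a c : ℤ} (ha : 0 ≤ a) (hc : c < 0) : CC a c = 0 := by
  unfold CC
  rw [if_neg (by omega), if_neg (by omega)]

lemma CC_eq_zero_of_lt {a c : ℤ} (hc : 0 ≤ c) (h : a < c) : CC a c = 0 := by
  unfold CC
  rw [if_neg (by omega), if_neg (by omega)]

/-- Pascal's rule for the extended binomial coefficients. -/
lemma CC_add_one {a c : ℤ} (ha : -1 ≤ a) (hc : 0 ≤ c) :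
    CC (a + 1) c = CC a c + CC a (c - 1) := by
  lift c to ℕ using hc
  rcases ha.eq_or_lt with rfl | ha
  · rcases c with _ | c
    · simp [CC]
    · rw [CC_eq_zero_of_lt (by omega) (by omega), CC_eq_zero_of_lt (by omega) (by omega),
        CC_eq_zero_of_lt (by omega) (by omega), add_zero]
  · lift a to ℕ using by omega
    rcases c with _ | c
    · rw [CC_eq_zero_of_neg (c := ((0 : ℕ) : ℤ) - 1) (by omega) (by simp),
        ← Nat.cast_add_one, CC_natCast, CC_natCast]
      simp
    · rw [← Nat.cast_add_one, Nat.cast_add_one c, add_sub_cancel_right, ← Nat.cast_add_one,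
        CC_natCast, CC_natCast, CC_natCast, Nat.choose_succ_succ', Nat.cast_add, add_comm]

/-- The coefficient of `f_{p,s}(Y_i, Y_j)`, extended to all pairs of indices `i, j`. -/
def symCoef (p i j : ℕ) : ℂ :=
  if i ≤ p ∧ p ≤ j then fcoef p i j else if j ≤ p ∧ p ≤ i then fcoef p j i else 0

lemma symCoef_comm (p i j : ℕ) : symCoef p i j = symCoef p j i := by
  unfold symCoef
  split_ifs with h h'
  · obtain rfl : i = p := by omega
    obtain rfl : j = i := by omega
    rfl
  all_goals rfl

lemma fcoef_eq_zero {p i j : ℕ} (hi : i ≤ p) (hj : p ≤ j) (h : i + j < 2 * p) :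
    fcoef p i j = 0 := by
  unfold fcoef
  rw [CC_eq_zero_of_lt (by omega) (by omega), CC_eq_zero_of_lt (by omega) (by omega)]
  simp

lemma symCoef_eq_zero {p i j : ℕ} (h : i + j < 2 * p) : symCoef p i j = 0 := by
  unfold symCoef
  split_ifs with h₁ h₂
  · exact fcoef_eq_zero h₁.1 h₁.2 h
  · exact fcoef_eq_zero h₂.1 h₂.2 (by omega)
  · rfl

lemma fcoef_self (p : ℕ) : fcoef p p p = 1 := by
  norm_num [fcoef, CC]

lemma fcoef_self_left {p j : ℕ} (h : p < j) : fcoef p p j = 1 / 2 := by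
  unfold fcoef
  rw [CC_eq_zero_of_neg (a := (j : ℤ) - p - 1) (by omega) (by omega), sub_self,
    ← Nat.cast_sub h.le, ← Nat.cast_zero, CC_natCast]
  simp

lemma fcoef_rec {p i j : ℕ} (hi : i < p) (hj : p ≤ j) :
    fcoef p (i + 1) j + fcoef p i (j + 1) = fcoef p i j := by
  obtain ⟨r, rfl⟩ := Nat.exists_eq_add_of_lt hi
  have e₁ := CC_add_one (a := (j : ℤ) - (i + r + 1 : ℕ)) (c := r + 1) (by omega) (by omega)
  have e₂ := CC_add_one (a := (j : ℤ) - (i + r + 1 : ℕ) - 1) (c := r) (by omega) (by omega)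
  have h₁ : i + r + 1 - (i + 1) = r := by omega
  have h₂ : i + r + 1 - i = r + 1 := by omega
  unfold fcoef
  rw [h₁, h₂, pow_succ]
  push_cast at *
  ring_nf at *
  rw [e₁, e₂]
  ring

lemma symCoef_rec_of_le (p : ℕ) {i j : ℕ} (h : i ≤ j) :
    symCoef p (i + 1) j + symCoef p i (j + 1) = symCoef p i j := by
  rcases h.eq_or_lt with rfl | h
  · rw [symCoef_comm p (i + 1)]
    rcases lt_trichotomy i p with hp | rfl | hp
    · rw [symCoef_eq_zero (j := i) (by omega)]
      rcases (Nat.succ_le_of_lt hp).eq_or_lt with rfl | hp'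
      · rw [symCoef_eq_zero (by omega), add_zero]
      · rw [symCoef_eq_zero (by omega), add_zero]
    · simp only [symCoef, le_refl, Nat.le_succ, and_self, if_true]
      rw [fcoef_self_left (by omega), fcoef_self]
      norm_num
    · simp [symCoef, hp.not_ge, show ¬ i + 1 ≤ p by omega]
  · rcases lt_trichotomy i p with hp | rfl | hp
    · rcases le_or_gt p j with hj | hj
      · simp only [symCoef]
        rw [if_pos (by omega), if_pos (by omega), if_pos (by omega), fcoef_rec hp hj]
      · rw [symCoef_eq_zero (by omega), symCoef_eq_zero (by omega), symCoef_eq_zero (by omega),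
          add_zero]
    · simp only [symCoef]
      rw [if_neg (by omega), if_neg (by omega), if_pos (by omega), if_pos (by omega),
        fcoef_self_left h, fcoef_self_left (by omega), zero_add]
    · simp only [symCoef]
      rw [if_neg (by omega), if_neg (by omega), if_neg (by omega), if_neg (by omega),
        if_neg (by omega), if_neg (by omega), add_zero]

lemma symCoef_rec (p i j : ℕ) :
    symCoef p (i + 1) j + symCoef p i (j + 1) = symCoef p i j := by
  rcases le_total i j with h | h
  · exact symCoef_rec_of_le p h
  · rw [symCoef_comm p (i + 1), symCoef_comm p i, symCoef_comm p i j, add_comm]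
    exact symCoef_rec_of_le p h

/-- The part of the coefficient `symCoef p j (m + 1)` that depends on `p` and is nonzero. -/
def colWeight (m q p : ℕ) : ℂ :=
  (-1) ^ p * (m - p).factorial / ((p - 1).factorial * (m + q + 1 - 2 * p).factorial)

lemma colWeight_ne_zero (m q p : ℕ) : colWeight m q p ≠ 0 := by
  simp [colWeight, Nat.factorial_ne_zero]

lemma symCoef_eq_colWeight_mul {m q p j : ℕ} (hj : 1 ≤ j) (hjq : j ≤ q) (hq : q < m)
    (hp : 1 ≤ p) (hpm : p ≤ m) (hpq : 2 * p ≤ m + q + 1) :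
    symCoef p j (m + 1) = (-1) ^ j * (m + 1 - j) / 2 * (colWeight m q p *
      ((p - 1).descFactorial (j - 1) * (m + q + 1 - 2 * p).descFactorial (q - j) : ℕ)) := by
  rcases lt_or_ge p j with h | h
  · rw [Nat.descFactorial_eq_zero_iff_lt.2 (show p - 1 < j - 1 by omega)]
    simp [symCoef, h.not_ge, show ¬ m + 1 ≤ p by omega]
  rcases lt_or_ge (j + (m + 1)) (2 * p) with h' | h'
  · rw [symCoef_eq_zero h',
      Nat.descFactorial_eq_zero_iff_lt.2 (show m + q + 1 - 2 * p < q - j by omega)]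
    simp
  obtain ⟨r, rfl⟩ := Nat.exists_eq_add_of_le h
  obtain ⟨t, rfl⟩ := Nat.exists_eq_add_of_le hjq
  obtain ⟨e, he⟩ := Nat.exists_eq_add_of_le h'
  obtain ⟨i, rfl⟩ := Nat.exists_eq_add_of_le hj
  obtain ⟨N, hN⟩ : ∃ N, r + e = N + 1 := ⟨r + e - 1, by omega⟩
  obtain rfl : m = i + r + N + 1 := by omega
  have e₁ := Nat.factorial_mul_descFactorial (show i ≤ i + r by omega)
  have e₂ := Nat.factorial_mul_descFactorial (show t ≤ e + t by omega)
  simp only [Nat.add_sub_cancel_left, Nat.add_sub_cancel] at e₁ e₂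
  have d₁ : 1 + i + r - 1 = i + r := by omega
  have d₂ : 1 + i - 1 = i := by omega
  have d₃ : i + r + N + 1 + (1 + i + t) + 1 - 2 * (1 + i + r) = e + t := by omega
  have d₄ : i + r + N + 1 - (1 + i + r) = N := by omega
  have d₅ : 1 + i + r - (1 + i) = r := by omega
  have d₆ : 1 + i + t - (1 + i) = t := by omega
  unfold symCoef fcoef colWeight
  rw [if_pos (by omega), d₁, d₂, d₃, d₄, d₅, d₆]
  have b₁ : CC (((i + r + N + 1 + 1 : ℕ) : ℤ) - (1 + i + r : ℕ))
      (((1 + i + r : ℕ) : ℤ) - (1 + i : ℕ)) = (N + 1).choose r := by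
    rw [← CC_natCast]; congr 1 <;> push_cast <;> ring
  have b₂ : ((N + 1).choose r : ℂ) * (r.factorial * e.factorial) = (N + 1).factorial := by
    have := Nat.choose_mul_factorial_mul_factorial (show r ≤ N + 1 by omega)
    rw [show N + 1 - r = e by omega] at this
    exact_mod_cast (mul_assoc _ _ _).symm.trans this
  have b₃ : CC (((i + r + N + 1 + 1 : ℕ) : ℤ) - (1 + i + r : ℕ) - 1)
      (((1 + i + r : ℕ) : ℤ) - (1 + i : ℕ) - 1) * (r.factorial * e.factorial) =
        r * N.factorial := by
    rcases r with _ | r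
    · rw [CC_eq_zero_of_neg (by omega) (by omega)]; simp
    · have : CC (((i + (r + 1) + N + 1 + 1 : ℕ) : ℤ) - (1 + i + (r + 1) : ℕ) - 1)
        (((1 + i + (r + 1) : ℕ) : ℤ) - (1 + i : ℕ) - 1) = N.choose r := by
        rw [← CC_natCast]; congr 1 <;> push_cast <;> ring
      rw [this]
      have := Nat.choose_mul_factorial_mul_factorial (show r ≤ N by omega)
      rw [show N - r = e by omega] at this
      rw [← this, Nat.factorial_succ]
      push_cast
      ring
  have c₁ : ((i + r).descFactorial i : ℂ) = (i + r).factorial / r.factorial := by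
    rw [eq_div_iff (by simp [Nat.factorial_ne_zero]), mul_comm]; exact_mod_cast e₁
  have c₂ : ((e + t).descFactorial t : ℂ) = (e + t).factorial / e.factorial := by
    rw [eq_div_iff (by simp [Nat.factorial_ne_zero]), mul_comm]; exact_mod_cast e₂
  have hs : (-1 : ℂ) ^ (1 + i) * (-1) ^ (1 + i + r) = (-1) ^ r := by
    rw [pow_add _ (1 + i), ← mul_assoc, ← mul_pow]; simp
  have f₁ : (r.factorial : ℂ) ≠ 0 := by simp [Nat.factorial_ne_zero]
  have f₂ : (e.factorial : ℂ) ≠ 0 := by simp [Nat.factorial_ne_zero]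
  have f₃ : ((i + r).factorial : ℂ) ≠ 0 := by simp [Nat.factorial_ne_zero]
  have f₄ : ((e + t).factorial : ℂ) ≠ 0 := by simp [Nat.factorial_ne_zero]
  rw [b₁, ← hs, Nat.cast_mul, c₁, c₂]
  refine mul_right_cancel₀ (mul_ne_zero f₁ f₂) ?_
  rw [mul_assoc, add_mul, b₂, b₃, Nat.factorial_succ]
  field_simp
  push_cast
  ring

lemma sum_neg_one_pow_mul_choose_mul_eval (P : Polynomial ℂ) {q : ℕ} (hP : P.natDegree < q)
    (x : ℂ) : ∑ k ∈ range (q + 1), (-1) ^ k * (q.choose k : ℂ) * P.eval (x + k) = 0 := by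
  have h := congrFun (Polynomial.fwdDiff_iter_eq_zero_of_degree_lt hP) x
  rw [fwdDiff_iter_eq_sum_shift] at h
  have h' := congrArg ((-1 : ℂ) ^ q * ·) h
  simp only [Pi.zero_apply, mul_zero, mul_sum] at h'
  rw [← h']
  refine sum_congr rfl fun k hk => ?_
  have hk : k ≤ q := by simpa [Nat.lt_succ_iff] using hk
  have hs : (-1 : ℂ) ^ q * (-1) ^ (q - k) = (-1) ^ k := by
    obtain ⟨l, rfl⟩ := Nat.exists_eq_add_of_le hk
    rw [Nat.add_sub_cancel_left, pow_add, mul_assoc, ← mul_pow]; simp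
  rw [← hs]
  simp
  ring

open Polynomial in
lemma sum_neg_one_pow_mul_choose_mul_descFactorial {m q p j : ℕ} (hj : 1 ≤ j) (hjq : j ≤ q)
    (hp : 1 ≤ p) (hpq : 2 * (p + q) ≤ m + q + 1) :
    ∑ k ∈ range (q + 1), (-1) ^ k * (q.choose k : ℂ) * ((p + k - 1).descFactorial (j - 1) *
      (m + q + 1 - 2 * (p + k)).descFactorial (q - j) : ℕ) = 0 := by
  have hdeg : ((descPochhammer ℂ (j - 1)).comp (X - C 1) *
      (descPochhammer ℂ (q - j)).comp (C (m + q + 1 : ℂ) - C 2 * X)).natDegree < q := by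
    have h : (C (m + q + 1 : ℂ) - C 2 * X).natDegree ≤ 1 := by compute_degree
    refine natDegree_mul_le.trans_lt ?_
    rw [natDegree_comp, natDegree_comp, descPochhammer_natDegree, descPochhammer_natDegree,
      natDegree_X_sub_C]
    have := Nat.mul_le_mul_left (q - j) h
    omega
  rw [← sum_neg_one_pow_mul_choose_mul_eval _ hdeg p]
  refine sum_congr rfl fun k hk => ?_
  have hk : k ≤ q := by simpa [Nat.lt_succ_iff] using hk
  congr 1
  rw [Nat.cast_mul, ← descPochhammer_eval_eq_descFactorial, ← descPochhammer_eval_eq_descFactorial,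
    Nat.cast_sub (by omega), Nat.cast_sub (by omega), eval_mul, eval_comp, eval_comp]
  simp

/-- The coefficients `α_k` (with `α_0 = 1`) of the cocycle of type `(p,s)`. -/
def cocycleCoef (m q p k : ℕ) : ℂ :=
  (-1) ^ k * q.choose k * (colWeight m q p / colWeight m q (p + k))

lemma cocycleCoef_zero (m q p : ℕ) : cocycleCoef m q p 0 = 1 := by
  simp [cocycleCoef, colWeight_ne_zero]

lemma sum_cocycleCoef_mul_symCoef {m q p j : ℕ} (hj : 1 ≤ j) (hjq : j ≤ q) (hq : q < m)
    (hp : 1 ≤ p) (hpq : 2 * (p + q) ≤ m + q + 1) :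
    ∑ k ∈ range (q + 1), cocycleCoef m q p k * symCoef (p + k) j (m + 1) = 0 := by
  rw [← mul_zero ((-1) ^ j * (m + 1 - j) / 2 * colWeight m q p),
    ← sum_neg_one_pow_mul_choose_mul_descFactorial hj hjq hp hpq, mul_sum]
  refine sum_congr rfl fun k hk => ?_
  have hk : k ≤ q := by simpa [Nat.lt_succ_iff] using hk
  rw [symCoef_eq_colWeight_mul hj hjq hq (by omega) (by omega) (by omega), cocycleCoef]
  have := colWeight_ne_zero m q (p + k)
  field_simp

lemma bil_apply {ι κ : Type} [Fintype ι] [DecidableEq ι] [Fintype κ] [DecidableEq κ]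
    {M : Type} [AddCommGroup M] [Module ℂ M] (f : ι → κ → M) (x : ι → ℂ) (y : κ → ℂ) :
    bil f x y = ∑ i, ∑ j, (x i * y j) • f i j := rfl

lemma bil_single {ι κ : Type} [Fintype ι] [DecidableEq ι] [Fintype κ] [DecidableEq κ]
    {M : Type} [AddCommGroup M] [Module ℂ M] (f : ι → κ → M) (i : ι) (j : κ) :
    bil f (Pi.single i 1) (Pi.single j 1) = f i j := by
  simp [bil_apply, Pi.single_apply]

lemma Xz_apply_zero (n : ℕ) (k : ℤ) : Xz n k 0 = 0 := by
  unfold Xz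
  split_ifs with h
  · rw [Pi.single_apply, if_neg]
    simp only [Fin.ext_iff, Fin.val_zero]
    omega
  · rfl

lemma Xz_eq_zero {n : ℕ} {k : ℤ} (h : k ≤ 0 ∨ n < k) : Xz n k = 0 := by
  unfold Xz
  rw [dif_neg (by omega)]

lemma Xb_eq_Xz {n : ℕ} (h : 1 ≤ n) : Xb n n = Xz n n := by
  simp [Xb, Xz, h]

lemma rho0_eq_zero {n m : ℕ} {g : V0 n} (hg : g 0 = 0) (h : V1 m) : rho0 n m g h = 0 := by
  rw [rho0, bil_apply]
  refine sum_eq_zero fun i _ => sum_eq_zero fun j _ => ?_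
  split_ifs with hi
  · obtain rfl : i = 0 := Fin.ext hi
    simp [hg]
  · simp

lemma rho0_single {n m : ℕ} (g : V0 n) (j : Fin m) :
    rho0 n m g (Pi.single j 1) = g 0 • Yb m (j + 2) := by
  rw [rho0, bil_apply, sum_eq_single 0]
  · simp [Pi.single_apply]
  · intro i _ hi
    have hi : (i : ℕ) ≠ 0 := Fin.val_ne_zero_iff.2 hi
    simp [hi]
  · simp

lemma mu0_Xz {n : ℕ} (g : V0 n) {k : ℤ} (hk : 1 ≤ k) :
    mu0 n g (Xz n k) = g 0 • Xz n (k + 1) := by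
  rcases lt_or_ge (n : ℤ) k with h | h
  · rw [Xz_eq_zero (.inr h), Xz_eq_zero (.inr (by omega))]
    simp
  · rw [Xz, dif_pos ⟨hk, h⟩, mu0, bil_apply, sum_eq_single 0]
    · rw [sum_eq_single (⟨k.toNat, by omega⟩ : Fin (n + 1))]
      · have : 1 ≤ k.toNat := by omega
        simp [this, show 0 ≤ k by omega]
      · intro j _ hj
        simp [hj]
      · simp
    · intro i _ hi
      refine sum_eq_zero fun j _ => ?_
      by_cases hj : j = (⟨k.toNat, by omega⟩ : Fin (n + 1))
      · subst hj
        have hi : (i : ℕ) ≠ 0 := Fin.val_ne_zero_iff.2 hi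
        rw [if_neg (by simp [hi]), if_neg (by simp; omega), smul_zero]
      · simp [hj]
    · simp

lemma bilin_ext {m : ℕ} {M : Type} [AddCommGroup M] [Module ℂ M] {B : V1 m → V1 m → M}
    (T : V1 m →ₗ[ℂ] V1 m →ₗ[ℂ] M) (hT : ∀ h h', T h h' = B h h')
    (hB : ∀ i j, B (Pi.single i 1) (Pi.single j 1) = 0) (h h' : V1 m) : B h h' = 0 := by
  have : T = 0 := by
    ext i j
    simp [hT, hB]
  rw [← hT, this]; rfl

/-- The bilinear map `(Y_i, Y_j) ↦ c i j • X_{d+i+j}`. -/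
def gradedBil (n m : ℕ) (d : ℤ) (c : ℕ → ℕ → ℂ) : V1 m →ₗ[ℂ] V1 m →ₗ[ℂ] V0 n :=
  bil fun i j => c (i + 1) (j + 1) • Xz n (d + ((i : ℕ) + 1) + ((j : ℕ) + 1))

lemma gradedBil_apply_zero (n m : ℕ) (d : ℤ) (c : ℕ → ℕ → ℂ) (h h' : V1 m) :
    gradedBil n m d c h h' 0 = 0 := by
  simp [gradedBil, bil_apply, Finset.sum_apply, Xz_apply_zero]

lemma gradedBil_symm (n m : ℕ) (d : ℤ) {c : ℕ → ℕ → ℂ} (hc : ∀ i j, c i j = c j i)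
    (h h' : V1 m) : gradedBil n m d c h h' = gradedBil n m d c h' h := by
  rw [gradedBil, bil_apply, bil_apply, sum_comm]
  refine sum_congr rfl fun i _ => sum_congr rfl fun j _ => ?_
  rw [mul_comm, hc, add_right_comm]

lemma gradedBil_Yb_single {n m : ℕ} {d : ℤ} {c : ℕ → ℕ → ℂ}
    (hm : ∀ j, 1 ≤ j → j ≤ m → d + (m + 1) + j ≤ n → c (m + 1) j = 0) (i j : Fin m) :
    gradedBil n m d c (Yb m (i + 2)) (Pi.single j 1) =
      c (i + 2) (j + 1) • Xz n (d + ((i : ℕ) + 2) + ((j : ℕ) + 1)) := by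
  by_cases hi : (i : ℕ) + 2 ≤ m
  · rw [Yb, dif_pos (by omega), gradedBil, bil_single]
    norm_num
    ring_nf
  · have hi : (i : ℕ) + 1 = m := by omega
    rw [Yb, dif_neg (by omega), map_zero, LinearMap.zero_apply]
    by_cases hd : d + (m + 1) + ((j : ℕ) + 1) ≤ n
    · have := hm (j + 1) (by omega) (by omega) (by push_cast; omega)
      rw [show (i : ℕ) + 2 = m + 1 by omega, this, zero_smul]
    · rw [Xz_eq_zero (by omega), smul_zero]

lemma isBCocycle_gradedBil {n m : ℕ} {d : ℤ} {c : ℕ → ℕ → ℂ} (hc : ∀ i j, c i j = c j i)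
    (hrec : ∀ i j, c (i + 1) j + c i (j + 1) = c i j)
    (hneg : ∀ i j : ℕ, d + i + j ≤ 0 → c i j = 0)
    (hm : ∀ j, 1 ≤ j → j ≤ m → d + (m + 1) + j ≤ n → c (m + 1) j = 0) :
    IsBCocycle n m (gradedBil n m d c) := by
  refine ⟨gradedBil_symm n m d hc, fun g => ?_, fun h h' h'' => ?_⟩
  · let T := (gradedBil n m d c).comp (rho0 n m g)
    refine bilin_ext (T + T.flip - (gradedBil n m d c).compr₂ (mu0 n g)) (fun _ _ => rfl) ?_
    intro i j
    rw [rho0_single, rho0_single, map_smul, map_smul, LinearMap.smul_apply, LinearMap.smul_apply,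
      gradedBil_Yb_single hm, gradedBil_Yb_single hm, gradedBil, bil_single, map_smul]
    have e := hrec (i + 1) (j + 1)
    rcases le_or_gt (d + ((i : ℕ) + 1) + ((j : ℕ) + 1)) 0 with h | h
    · have h₀ : c (i + 1) (j + 1) = 0 := hneg _ _ (by push_cast; omega)
      rw [h₀] at e
      rw [h₀, zero_smul, sub_zero, hc (j + 2), ← smul_add,
        show d + ((j : ℕ) + 2) + ((i : ℕ) + 1) = d + ((i : ℕ) + 2) + ((j : ℕ) + 1) by ring,
        ← add_smul, e, zero_smul, smul_zero]
    · rw [mu0_Xz _ h, ← e, hc (j + 2),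
        show d + ((j : ℕ) + 2) + ((i : ℕ) + 1) = d + ((i : ℕ) + 2) + ((j : ℕ) + 1) by ring,
        show d + ((i : ℕ) + 1) + ((j : ℕ) + 1) + 1 = d + ((i : ℕ) + 2) + ((j : ℕ) + 1) by ring]
      module
  · rw [rho0_eq_zero, rho0_eq_zero, rho0_eq_zero, add_zero, add_zero] <;>
      exact gradedBil_apply_zero ..

lemma fps_eq_gradedBil {n m p s : ℕ} (hp : 1 ≤ p) (hs : 1 ≤ s) (hsn : s ≤ n)
    (h : p < m ∨ p = m ∧ s = n) :
    fps n m p s = gradedBil n m ((s : ℤ) - 2 * p) (symCoef p) := by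
  unfold fps gradedBil
  rcases h with h | ⟨rfl, rfl⟩
  · rw [if_neg (by omega), if_pos (by omega)]
    congr! 3 with i j
    unfold symCoef
    split_ifs <;> simp
  · rw [if_pos ⟨rfl, rfl⟩]
    congr! 3 with i j
    split_ifs with h
    · rw [h.1, h.2, symCoef, if_pos ⟨le_rfl, le_rfl⟩, fcoef_self, one_smul, Xb_eq_Xz hs]
      congr 1
      have : ((i : ℕ) : ℤ) + 1 = p := by exact_mod_cast h.1
      have : ((j : ℕ) : ℤ) + 1 = p := by exact_mod_cast h.2
      omega
    · rw [symCoef_eq_zero (by omega), zero_smul]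

lemma sum_smul_gradedBil (n m : ℕ) (d : ℤ) (q : ℕ) (a : ℕ → ℂ) (c : ℕ → ℕ → ℕ → ℂ) :
    ∑ k ∈ range q, a k • gradedBil n m d (c k) =
      gradedBil n m d fun i j => ∑ k ∈ range q, a k * c k i j := by
  refine LinearMap.ext fun h => LinearMap.ext fun h' => ?_
  rw [LinearMap.sum_apply, LinearMap.sum_apply]
  simp only [LinearMap.smul_apply, gradedBil, bil_apply, smul_sum, sum_smul]
  rw [sum_comm]
  refine sum_congr rfl fun i _ => ?_
  rw [sum_comm]
  refine sum_congr rfl fun j _ => sum_congr rfl fun k _ => ?_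
  module

lemma isBCocycle_sum_cocycleCoef_smul_fps {n m q p s : ℕ} (hq : q < m) (hp : 1 ≤ p)
    (hs₁ : 1 ≤ s) (hpq : 2 * (p + q) ≤ m + q + 1) (hs : s + m + q + 1 = n + 2 * p) :
    IsBCocycle n m (∑ k ∈ range (q + 1), cocycleCoef m q p k • fps n m (p + k) (s + 2 * k)) := by
  have key : ∑ k ∈ range (q + 1), cocycleCoef m q p k • fps n m (p + k) (s + 2 * k) =
      gradedBil n m ((s : ℤ) - 2 * p)
        fun i j => ∑ k ∈ range (q + 1), cocycleCoef m q p k * symCoef (p + k) i j := by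
    rw [← sum_smul_gradedBil n m _ (q + 1) _ fun k => symCoef (p + k)]
    refine sum_congr rfl fun k hk => ?_
    have hk : k ≤ q := by simpa [Nat.lt_succ_iff] using hk
    rw [fps_eq_gradedBil (by omega) (by omega) (by omega) (by omega)]
    congr 2
    push_cast
    ring
  rw [key]
  refine isBCocycle_gradedBil (fun i j => ?_) (fun i j => ?_) (fun i j h => ?_)
    fun j hj _ hjn => ?_
  · simp only [symCoef_comm _ i j]
  · rw [← sum_add_distrib]
    simp only [← mul_add, symCoef_rec]
  · exact sum_eq_zero fun k _ => by rw [symCoef_eq_zero (by omega), mul_zero]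
  · simp only [symCoef_comm _ (m + 1) j]
    exact sum_cocycleCoef_mul_symCoef hj (by omega) hq hp hpq

/-- For suitable `(p, q)` and `s = n - m - q - 1 + 2p`, the set `A_{p,s}` is nonempty:
there are coefficients `α_1, …, α_q` making `f_{p,s} + Σ α_k f_{p+k,s+2k}` a b-cocycle. -/
theorem Aset_nonempty_of_admissible (n m q p s : ℕ) (hn : 3 ≤ n) (hm : 2 ≤ m)
    (hq1 : 1 ≤ q) (hq2 : q ≤ min (m - 1) (n - 2))
    (hp1 : 1 ≤ p) (hp2 : (2 : ℤ) + m + q - n ≤ 2 * p) (hp3 : (2 * p : ℤ) ≤ (m : ℤ) - q + 1)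
    (hs : (s : ℤ) = (n : ℤ) - m - q - 1 + 2 * p) :
    (Aset n m p s).Nonempty ∧
    ∃ α : Fin q → ℂ, IsBCocycle n m
      (fps n m p s + ∑ k : Fin q, α k • fps n m (p + (k : ℕ) + 1) (s + 2 * ((k : ℕ) + 1))) := by
  have hcoc := isBCocycle_sum_cocycleCoef_smul_fps (n := n) (m := m) (q := q) (p := p) (s := s)
    (by omega) hp1 (by omega) (by omega) (by omega)
  rw [sum_range_succ', cocycleCoef_zero, one_smul, add_comm] at hcoc
  refine ⟨⟨fun k => if (k : ℕ) < q then cocycleCoef m q p (k + 1) else 0, ?_⟩,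
    fun k => cocycleCoef m q p (k + 1), ?_⟩
  · rw [Aset, Set.mem_ofPred_eq, bps,
      Fin.sum_univ_eq_sum_range (fun k => (if k < q then cocycleCoef m q p (k + 1) else 0) •
        fps n m (p + k + 1) (s + 2 * (k + 1))) (m - p),
      ← sum_subset (range_subset_range.2 (show q ≤ m - p by omega))]
    · convert! hcoc using 2
      refine sum_congr rfl fun k hk => ?_
      rw [if_pos (mem_range.1 hk), add_assoc]
    · intro k _ hk
      rw [if_neg (by simpa using hk), zero_smul]
  · rw [Fin.sum_univ_eq_sum_range (fun k => cocycleCoef m q p (k + 1) •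
        fps n m (p + k + 1) (s + 2 * (k + 1))) q]
    exact hcoc

end
end
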